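/- arXiv:1804.11302 — 2 statements merged into one kernel-verified Lean document; each statement's English description precedes it below -/
import Mathlib

section
/- Let s ≥ 3 and s+2 ≤ t ≤ 2s-1 be integers and let Q be a colour scheme for K_t with parameter s. Then, among all induced subconfigurations of Q on at least two nodes, the minimal value is at most 0, and any induced subconfiguration attaining this minimal value that has the maximal number of nodes among such minimizers has at least 3 nodes. -/
/-- The pair `(s,t)` is regular if `s ≥ 11` and `s+3 ≤ t ≤ 2s-4`, or if
`(s,t) ∈ {(10,14),(10,15)}`. -/
def IsRegularPair (s t : ℕ) : Prop :=
  (11 ≤ s ∧ s + 3 ≤ t ∧ t ≤ 2 * s - 4) ∨ (s = 10 ∧ t = 14) ∨ (s = 10 ∧ t = 15)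

open Classical in
/-- The exponent `α = α_{s,t}`. -/
noncomputable def ERalpha (s t : ℕ) : ℝ :=
  if IsRegularPair s t then
    (((s : ℝ) - 2) * ((t : ℝ) - (s : ℝ)) * ((t : ℝ) + (s : ℝ) - 1) + 2 * (t : ℝ) - 2 * (s : ℝ)) /
      ((2 * (s : ℝ) - 3) * ((t : ℝ) - (s : ℝ)) * ((t : ℝ) + (s : ℝ) - 1) - 2 * (s : ℝ) + 4)
  else
    (((s : ℝ) - 2) * ((t : ℝ) - (s : ℝ)) * ((s : ℝ) - 1) + (s : ℝ) - 1) /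
      ((2 * (s : ℝ) - 3) * ((t : ℝ) - (s : ℝ)) * ((s : ℝ) - 1) + 2 * (s : ℝ) - (t : ℝ))

/-- `δ = s - (2s-1)α`. -/
noncomputable def ERdelta (s t : ℕ) : ℝ := (s : ℝ) - (2 * (s : ℝ) - 1) * ERalpha s t

/-- `η = 2(1-α) - δ`. -/
noncomputable def EReta (s t : ℕ) : ℝ := 2 * (1 - ERalpha s t) - ERdelta s t

/-- A colour scheme for `K_t` with parameter `s`: a set of `t` nodes together with a
family of blocks (colours), each of size at least `2` and at most `s`, such that every
pair of distinct nodes is contained in exactly one block. -/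
structure ColourScheme (s t : ℕ) where
  blocks : Finset (Finset (Fin t))
  two_le_card : ∀ D ∈ blocks, 2 ≤ D.card
  card_le_s : ∀ D ∈ blocks, D.card ≤ s
  existsUnique_block : ∀ x y : Fin t, x ≠ y → ∃! D, D ∈ blocks ∧ x ∈ D ∧ y ∈ D

/-- The value `v(Q) = t - 2 + (b-1)δ + (l-2)(α-1)` of a scheme, where `b` is the number
of blocks and `l` the number of labels. -/
noncomputable def schemeValue {s t : ℕ} (Q : ColourScheme s t) : ℝ :=
  (t : ℝ) - 2 + ((Q.blocks.card : ℝ) - 1) * ERdelta s t +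
    ((∑ D ∈ Q.blocks, (D.card : ℝ)) - 2) * (ERalpha s t - 1)

/-- The value of the subconfiguration of a scheme `Q` induced by a set `S` of nodes:
its nodes are the elements of `S`, its colours are the blocks of `Q` meeting `S` in at
least two nodes, and each such colour labels the nodes of `S` it contains. -/
noncomputable def subconfigValue {s t : ℕ} (Q : ColourScheme s t) (S : Finset (Fin t)) : ℝ :=
  (S.card : ℝ) - 2 +
    (((Q.blocks.filter (fun D => 2 ≤ (D ∩ S).card)).card : ℝ) - 1) * ERdelta s t +
    ((∑ D ∈ Q.blocks.filter (fun D => 2 ≤ (D ∩ S).card), ((D ∩ S).card : ℝ)) - 2) *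
      (ERalpha s t - 1)

/-- Double counting: every off-diagonal pair lies in exactly one block. -/
lemma pair_count {s t : ℕ} (Q : ColourScheme s t) (T : Finset (Fin t × Fin t))
    (hT : ∀ p ∈ T, p.1 ≠ p.2) :
    ∑ D ∈ Q.blocks, (T.filter (fun p => p.1 ∈ D ∧ p.2 ∈ D)).card = T.card := by
  simp_rw [Finset.card_filter]
  rw [Finset.sum_comm, Finset.card_eq_sum_ones]
  refine Finset.sum_congr rfl fun p hp => ?_
  obtain ⟨D, ⟨hD, hx, hy⟩, hu⟩ := Q.existsUnique_block p.1 p.2 (hT p hp)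
  rw [Finset.sum_eq_single D]
  · simp [hx, hy]
  · intro D' hD' hne
    have : ¬ (p.1 ∈ D' ∧ p.2 ∈ D') := fun h => hne (hu D' ⟨hD', h.1, h.2⟩)
    simp [this]
  · intro h; exact absurd hD h

lemma offDiag_cast {α : Type*} [DecidableEq α] (S : Finset α) :
    (S.offDiag.card : ℝ) = (S.card : ℝ) * ((S.card : ℝ) - 1) := by
  rw [Finset.offDiag_card, Nat.cast_sub (Nat.le_mul_self _)]
  push_cast; ring

lemma sum_all {s t : ℕ} (Q : ColourScheme s t) :
    ∑ D ∈ Q.blocks, (D.card : ℝ) * ((D.card : ℝ) - 1) = (t : ℝ) * ((t : ℝ) - 1) := by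
  have h := pair_count Q (Finset.univ : Finset (Fin t)).offDiag (by simp)
  have h2 : ((∑ D ∈ Q.blocks, ((Finset.univ : Finset (Fin t)).offDiag.filter
      (fun p => p.1 ∈ D ∧ p.2 ∈ D)).card : ℕ) : ℝ) = _ := congrArg _ h
  rw [offDiag_cast, Finset.card_univ, Fintype.card_fin] at h2
  rw [← h2]; push_cast
  refine Finset.sum_congr rfl fun D _ => ?_
  rw [← offDiag_cast]; congr 2
  ext p; simp [Finset.mem_offDiag]; tauto

lemma inter_le_one {s t : ℕ} (Q : ColourScheme s t) {D M : Finset (Fin t)}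
    (hD : D ∈ Q.blocks) (hM : M ∈ Q.blocks) (hne : D ≠ M) : (D ∩ M).card ≤ 1 := by
  rw [Finset.card_le_one]
  intro a ha b hb
  by_contra hab
  simp only [Finset.mem_inter] at ha hb
  exact hne ((Q.existsUnique_block a b hab).unique ⟨hD, ha.1, hb.1⟩ ⟨hM, ha.2, hb.2⟩)

lemma sum_cross {s t : ℕ} (Q : ColourScheme s t) {M : Finset (Fin t)} (hM : M ∈ Q.blocks) :
    ∑ D ∈ Q.blocks.erase M, ((D ∩ M).card : ℝ) * ((D \ M).card : ℝ)
      = (M.card : ℝ) * ((t : ℝ) - M.card) := by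
  have h := pair_count Q (M ×ˢ Mᶜ) (by
    rintro ⟨a, b⟩ hp hab
    simp only [Finset.mem_product, Finset.mem_compl] at hp hab
    exact hp.2 (hab ▸ hp.1))
  have h2 : ((∑ D ∈ Q.blocks, ((M ×ˢ Mᶜ).filter
      (fun p => p.1 ∈ D ∧ p.2 ∈ D)).card : ℕ) : ℝ) = _ := congrArg _ h
  have hc : M.card ≤ t := by simpa using Finset.card_le_univ M
  rw [Finset.card_product, Finset.card_compl, Fintype.card_fin, Nat.cast_mul,
    Nat.cast_sub hc] at h2
  rw [← h2]; push_cast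
  rw [← Finset.add_sum_erase _ _ hM]
  have h0 : ((M ×ˢ Mᶜ).filter (fun p => p.1 ∈ M ∧ p.2 ∈ M)) = ∅ := by
    ext p; simp; tauto
  rw [h0]; simp only [Finset.card_empty, Nat.cast_zero, zero_add]
  refine Finset.sum_congr rfl fun D _ => ?_
  rw [← Nat.cast_mul, ← Finset.card_product]; congr 2
  ext p; simp; tauto

lemma sum_out {s t : ℕ} (Q : ColourScheme s t) {M : Finset (Fin t)} (hM : M ∈ Q.blocks) :
    ∑ D ∈ Q.blocks.erase M, ((D \ M).card : ℝ) * (((D \ M).card : ℝ) - 1)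
      = ((t : ℝ) - M.card) * ((t : ℝ) - M.card - 1) := by
  have h := pair_count Q (Mᶜ).offDiag (by
    rintro ⟨a, b⟩ hp
    simp at hp; exact hp.2.2)
  have h2 : ((∑ D ∈ Q.blocks, ((Mᶜ).offDiag.filter
      (fun p => p.1 ∈ D ∧ p.2 ∈ D)).card : ℕ) : ℝ) = _ := congrArg _ h
  have hc : M.card ≤ t := by simpa using Finset.card_le_univ M
  rw [offDiag_cast, Finset.card_compl, Fintype.card_fin,
    Nat.cast_sub hc] at h2
  rw [← h2]; push_cast
  rw [← Finset.add_sum_erase _ _ hM]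
  have h0 : ((Mᶜ).offDiag.filter (fun p => p.1 ∈ M ∧ p.2 ∈ M)) = ∅ := by
    ext p; simp; tauto
  rw [h0]; simp only [Finset.card_empty, Nat.cast_zero, zero_add]
  refine Finset.sum_congr rfl fun D _ => ?_
  rw [← offDiag_cast]; congr 2
  ext p; simp; tauto

/-- A quadratic with nonpositive leading coefficient that is nonnegative at `2` and `r`
is nonnegative in between. -/
lemma concave_aux (β η c r j : ℝ) (hc : 0 ≤ c) (hcη : c ≤ η) (hj : 2 ≤ j) (hjr : j ≤ r)
    (hr : c / 2 * (r * (r - 1)) ≤ (r - 2) * β + η) :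
    c / 2 * (j * (j - 1)) ≤ (j - 2) * β + η := by
  rcases eq_or_lt_of_le hj with h | h
  · subst h; linarith
  have hr2 : 0 < r - 2 := by linarith
  have h1 : 0 ≤ (r - j) * (η - c) := mul_nonneg (by linarith) (by linarith)
  have h2 : 0 ≤ (j - 2) * ((r - 2) * β + η - c / 2 * (r * (r - 1))) :=
    mul_nonneg (by linarith) (by linarith)
  have h3 : 0 ≤ c / 2 * ((j - 2) * (r - j) * (r - 2)) :=
    mul_nonneg (by linarith) (mul_nonneg (mul_nonneg (by linarith) (by linarith)) hr2.le)
  have : 0 ≤ (r - 2) * ((j - 2) * β + η - c / 2 * (j * (j - 1))) := by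
    have e : (r - 2) * ((j - 2) * β + η - c / 2 * (j * (j - 1))) =
      (r - j) * (η - c) + (j - 2) * ((r - 2) * β + η - c / 2 * (r * (r - 1)))
        + c / 2 * ((j - 2) * (r - j) * (r - 2)) := by ring
    rw [e]; linarith
  have := nonneg_of_mul_nonneg_right this hr2
  linarith

/-- Main combinatorial inequality, all blocks small. -/
lemma total_small {s t : ℕ} (ht1 : s + 2 ≤ t) (Q : ColourScheme s t) (β η : ℝ)
    (h3 : 2 ≤ η * (t + 1))
    (h5 : ((t : ℝ) - 2 + η) * (((t : ℝ) - s) * ((t : ℝ) - s - 1)) ≤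
      (((t : ℝ) - s - 2) * β + η) * (t * (t - 1)))
    (hB : ∀ D ∈ Q.blocks, D.card ≤ t - s) :
    (t : ℝ) - 2 + η ≤ ∑ D ∈ Q.blocks, (((D.card : ℝ) - 2) * β + η) := by
  have hst : (s : ℝ) + 2 ≤ t := by exact_mod_cast ht1
  have hs0 : (0 : ℝ) ≤ s := Nat.cast_nonneg s
  have hη : 0 ≤ η := by
    by_contra h
    have : η * (t + 1) ≤ 0 := mul_nonpos_of_nonpos_of_nonneg (by linarith) (by linarith)
    linarith
  have hT : 0 < (t : ℝ) * (t - 1) := mul_pos (by linarith) (by linarith)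
  obtain ⟨c, hcdef⟩ : ∃ c, c = ((t : ℝ) - 2 + η) / (t * (t - 1)) * 2 := ⟨_, rfl⟩
  have hcT : c / 2 * (t * (t - 1)) = (t : ℝ) - 2 + η := by
    have : (t : ℝ) * (t - 1) ≠ 0 := hT.ne'
    rw [hcdef, mul_div_assoc, div_self two_ne_zero, mul_one]
    exact div_mul_cancel₀ _ this
  have hc0 : 0 ≤ c := by
    rw [hcdef]; exact mul_nonneg (div_nonneg (by linarith) hT.le) (by norm_num)
  have hcη : c ≤ η := by
    have : c / 2 * (t * (t - 1)) ≤ η / 2 * (t * (t - 1)) := by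
      rw [hcT]; nlinarith
    have := le_of_mul_le_mul_right this hT
    linarith
  rw [← hcT, ← sum_all Q, Finset.mul_sum]
  refine Finset.sum_le_sum fun D hD => ?_
  have hD2 : (2 : ℝ) ≤ D.card := by exact_mod_cast Q.two_le_card D hD
  have hDK : (D.card : ℝ) ≤ (t : ℝ) - s := by
    have := hB D hD
    have : D.card + s ≤ t := by omega
    have : (D.card : ℝ) + s ≤ t := by exact_mod_cast this
    linarith
  refine concave_aux β η c ((t : ℝ) - s) _ hc0 hcη hD2 hDK ?_
  refine le_of_mul_le_mul_right ?_ hT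
  refine le_trans (le_of_eq ?_) h5
  rw [← hcT]; ring

/-- Main combinatorial inequality, when a large block exists. -/
lemma total_large {s t : ℕ} (hs : 3 ≤ s) (ht1 : s + 2 ≤ t) (Q : ColourScheme s t) (β η : ℝ)
    (h2 : (t : ℝ) - 2 ≤ ((s : ℝ) - 2) * β + η * (((t : ℝ) - s) * (t + s - 1) / 2))
    (h3 : 2 ≤ η * (t + 1))
    (h4 : (t : ℝ) - 2 ≤ ((t : ℝ) - 3) * β + η + η * (((t : ℝ) - s) * (s - 1)))
    (h6 : β ≤ ((t : ℝ) - s) * η) (h7 : η ≤ β)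
    (M : Finset (Fin t)) (hM : M ∈ Q.blocks) (hMc : t + 1 ≤ M.card + s) :
    (t : ℝ) - 2 + η ≤ ∑ D ∈ Q.blocks, (((D.card : ℝ) - 2) * β + η) := by
  have hs' : (3 : ℝ) ≤ s := by exact_mod_cast hs
  have hst : (s : ℝ) + 2 ≤ t := by exact_mod_cast ht1
  have hMs : (M.card : ℝ) ≤ s := by exact_mod_cast Q.card_le_s M hM
  have hMc' : (t : ℝ) + 1 ≤ M.card + s := by exact_mod_cast hMc
  have hη : 0 ≤ η := by
    by_contra h
    have : η * (t + 1) ≤ 0 := mul_nonpos_of_nonpos_of_nonneg (by linarith) (by linarith)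
    linarith
  have hcr := sum_cross Q hM
  have hou := sum_out Q hM
  rw [← Finset.add_sum_erase _ _ hM]
  obtain ⟨k, hk⟩ : ∃ k : ℝ, k = M.card := ⟨_, rfl⟩
  rw [← hk] at hcr hou hMs hMc' ⊢
  obtain ⟨r, hr⟩ : ∃ r : ℝ, r = (t : ℝ) - k := ⟨_, rfl⟩
  rw [← hr] at hcr hou
  have hr2 : 2 ≤ r := by linarith
  have hβr : β ≤ r * η := h6.trans (mul_le_mul_of_nonneg_right (by linarith) hη)
  have key : ∀ c : ℝ, 0 ≤ c → c ≤ η → c * r ≤ 2 * (β - η) →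
      (k - 2) * β + η + η * (k * r) + c / 2 * (r * (r - 1)) ≤
      (k - 2) * β + η + ∑ D ∈ Q.blocks.erase M, (((D.card : ℝ) - 2) * β + η) := by
    intro c hc hcη hcr2
    rw [← hcr, ← hou, Finset.mul_sum, Finset.mul_sum, add_assoc, ← Finset.sum_add_distrib]
    refine add_le_add le_rfl (Finset.sum_le_sum fun D hD => ?_)
    have hDne := Finset.ne_of_mem_erase hD
    have hDb := Finset.mem_of_mem_erase hD
    have hi := inter_le_one Q hDb hM hDne
    have hsum : (D ∩ M).card + (D \ M).card = D.card := Finset.card_inter_add_card_sdiff D M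
    have hD2 := Q.two_le_card D hDb
    have hjr : ((D \ M).card : ℝ) ≤ r := by
      have h1 : (D \ M).card + M.card ≤ t := by
        have : (D \ M ∪ M).card ≤ t := by simpa using Finset.card_le_univ (D \ M ∪ M)
        rwa [Finset.card_union_of_disjoint Finset.sdiff_disjoint] at this
      have h1' : ((D \ M).card : ℝ) + M.card ≤ t := by exact_mod_cast h1
      rw [hr, hk]; linarith
    rw [← hsum]; push_cast
    interval_cases hic : (D ∩ M).card
    · have hj : (2 : ℝ) ≤ (D \ M).card := by
        have : 2 ≤ (D \ M).card := by omega
        exact_mod_cast this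
      have := concave_aux β η c r _ hc hcη hj hjr (by nlinarith)
      simpa using this
    · have hj : (1 : ℝ) ≤ (D \ M).card := by
        have : 1 ≤ (D \ M).card := by omega
        exact_mod_cast this
      have e1 : c * ((D \ M).card : ℝ) ≤ c * r := mul_le_mul_of_nonneg_left hjr hc
      have := mul_nonneg (sub_nonneg.2 hj)
        (show 0 ≤ 2 * (β - η) - c * ((D \ M).card : ℝ) by linarith)
      push_cast
      nlinarith
  rcases le_total (η * r) (2 * (β - η)) with hle | hle
  · refine le_trans ?_ (key η hη le_rfl hle)
    have hs2 : 0 < (s : ℝ) - 2 := by linarith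
    have g2 : 0 ≤ ((s : ℝ) - k) * (((t : ℝ) - 2) * (η * (t + 1) - 2)) :=
      mul_nonneg (by linarith) (mul_nonneg (by linarith) (by linarith))
    have gs : 0 ≤ (k - 2) * (((s : ℝ) - 2) * β + η * (((t : ℝ) - s) * (t + s - 1) / 2)
        - (t - 2)) := mul_nonneg (by linarith) (by linarith)
    have g3 : 0 ≤ η * ((k - 2) * ((s : ℝ) - k) * (s - 2)) :=
      mul_nonneg hη (mul_nonneg (mul_nonneg (by linarith) (by linarith)) hs2.le)
    have : 0 ≤ ((s : ℝ) - 2) * ((k - 2) * β + η * (k * r) + η / 2 * (r * (r - 1)) - (t - 2)) := by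
      have e : ((s : ℝ) - 2) * ((k - 2) * β + η * (k * r) + η / 2 * (r * (r - 1)) - (t - 2)) =
        ((s : ℝ) - k) * (((t : ℝ) - 2) * (η * (t + 1) - 2)) / 2 +
        (k - 2) * (((s : ℝ) - 2) * β + η * (((t : ℝ) - s) * (t + s - 1) / 2)
        - (t - 2)) + η * ((k - 2) * ((s : ℝ) - k) * (s - 2)) / 2 := by rw [hr]; ring
      rw [e]; linarith
    have := nonneg_of_mul_nonneg_right this hs2
    linarith
  · have hr0 : (0 : ℝ) < r := by linarith
    have hcr' : 2 * (β - η) / r * r = 2 * (β - η) := div_mul_cancel₀ _ hr0.ne'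
    refine le_trans ?_ (key (2 * (β - η) / r) (div_nonneg (by linarith) hr0.le)
      ((div_le_iff₀ hr0).2 hle) hcr'.le)
    have e : 2 * (β - η) / r / 2 * (r * (r - 1)) = (β - η) * (r - 1) := by
      field_simp
    rw [e]
    have g : 0 ≤ η * (((s : ℝ) - k) * (k - (t + 1 - s))) :=
      mul_nonneg hη (mul_nonneg (by linarith) (by linarith))
    rw [hr]
    nlinarith

lemma value_univ {s t : ℕ} (Q : ColourScheme s t) :
    subconfigValue Q Finset.univ = (t : ℝ) - 2 + EReta s t -
      ∑ D ∈ Q.blocks, (((D.card : ℝ) - 2) * (1 - ERalpha s t) + EReta s t) := by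
  have hf : Q.blocks.filter (fun D => 2 ≤ (D ∩ Finset.univ).card) = Q.blocks := by
    apply Finset.filter_true_of_mem
    intro D hD; simpa using Q.two_le_card D hD
  unfold subconfigValue
  rw [hf]
  simp only [Finset.inter_univ, Finset.card_univ, Fintype.card_fin, Finset.sum_add_distrib,
    ← Finset.sum_mul, Finset.sum_sub_distrib, Finset.sum_const, nsmul_eq_mul]
  unfold EReta; ring

lemma value_pair {s t : ℕ} (Q : ColourScheme s t) (S : Finset (Fin t)) (hS : S.card = 2) :
    subconfigValue Q S = 0 := by
  obtain ⟨x, y, hxy, rfl⟩ := Finset.card_eq_two.1 hS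
  obtain ⟨D, ⟨hD, hx, hy⟩, hu⟩ := Q.existsUnique_block x y hxy
  have hsub : ∀ E : Finset (Fin t), 2 ≤ (E ∩ {x, y}).card → x ∈ E ∧ y ∈ E := by
    intro E hE
    have h1 : E ∩ {x, y} = {x, y} :=
      Finset.eq_of_subset_of_card_le Finset.inter_subset_right (by rw [hS]; exact hE)
    have h2 : ({x, y} : Finset (Fin t)) ⊆ E := Finset.inter_eq_right.1 h1
    exact ⟨h2 (by simp), h2 (by simp)⟩
  have hDi : D ∩ {x, y} = {x, y} := by
    apply Finset.inter_eq_right.2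
    intro z hz
    simp only [Finset.mem_insert, Finset.mem_singleton] at hz
    rcases hz with rfl | rfl <;> assumption
  have hf : Q.blocks.filter (fun D => 2 ≤ (D ∩ {x, y}).card) = {D} := by
    ext E
    simp only [Finset.mem_filter, Finset.mem_singleton]
    constructor
    · rintro ⟨hE, h⟩
      exact hu E ⟨hE, hsub E h⟩
    · rintro rfl
      exact ⟨hD, by rw [hDi, hS]⟩
  unfold subconfigValue
  rw [hf, Finset.sum_singleton, hDi, hS]
  simp

/-- Consequences of the near-pencil bound. -/
lemma arith_low (s t β η : ℝ) (hst : s + 2 ≤ t) (hts : t + 1 ≤ 2 * s)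
    (hβ : (2 * s - 3) * β = s - 1 - η)
    (h4 : t * (s - 2) - s + 3 ≤ η * ((2 * s - 3) * ((t - s) * (s - 1)) + 2 * s - t)) :
    2 ≤ η * (t + 1) ∧ β ≤ (t - s) * η ∧
    (t - 2 + η) * ((t - s) * (t - s - 1)) ≤ ((t - s - 2) * β + η) * (t * (t - 1)) := by
  obtain ⟨u, hu⟩ : ∃ u, u = t - s - 2 := ⟨_, rfl⟩
  obtain ⟨v, hv⟩ : ∃ v, v = 2 * s - t - 1 := ⟨_, rfl⟩
  have hu0 : 0 ≤ u := by linarith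
  have hv0 : 0 ≤ v := by linarith
  obtain rfl : s = u + v + 3 := by linarith
  obtain rfl : t = 2 * u + v + 5 := by linarith
  obtain ⟨P, hP⟩ : ∃ P, P = (2 * (u + v + 3) - 3) * ((2 * u + v + 5 - (u + v + 3)) * (u + v + 3 - 1))
    + 2 * (u + v + 3) - (2 * u + v + 5) := ⟨_, rfl⟩
  have hP' : P = (2 * u + 2 * v + 3) * ((u + 2) * (u + v + 2)) + v + 1 := by rw [hP]; ring
  have hP0 : 0 < P := by rw [hP']; positivity
  rw [← hP] at h4
  have ha : 0 < 2 * (u + v + 3) - 3 := by linarith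
  have low : ∀ A C : ℝ, 0 ≤ A →
      0 ≤ ((2 * u + v + 5) * (u + v + 3 - 2) - (u + v + 3) + 3) * A - C * P → C ≤ η * A := by
    intro A C hA h
    refine le_of_mul_le_mul_right ?_ hP0
    have := mul_le_mul_of_nonneg_right h4 hA
    linarith
  refine ⟨?_, ?_, ?_⟩
  · apply low _ _ (by linarith)
    rw [hP']; ring_nf; positivity
  · have := low (1 + (u + 2) * (2 * u + 2 * v + 3)) (u + v + 2) (by positivity)
      (by rw [hP']; ring_nf; positivity)
    refine le_of_mul_le_mul_left ?_ ha
    rw [hβ]; linarith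
  · have := low ((u + 2 * v + 3) * ((2 * u + v + 5) * (2 * u + v + 4))
        - (2 * u + 2 * v + 3) * ((u + 2) * (u + 1)))
      ((2 * u + 2 * v + 3) * (2 * u + v + 3) * ((u + 2) * (u + 1))
        - u * (u + v + 2) * ((2 * u + v + 5) * (2 * u + v + 4))) (by ring_nf; positivity)
      (by rw [hP']; ring_nf; positivity)
    refine le_of_mul_le_mul_left ?_ ha
    have e : (2 * (u + v + 3) - 3) * (((2 * u + v + 5 - (u + v + 3) - 2) * β + η) * ((2 * u + v + 5) * (2 * u + v + 5 - 1))) =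
      (u * ((2 * (u + v + 3) - 3) * β) + (2 * (u + v + 3) - 3) * η) * ((2 * u + v + 5) * (2 * u + v + 5 - 1)) := by ring
    rw [e, hβ]; linarith

/-- The cubic deciding which of the two candidate extremal schemes is the relevant one. -/
noncomputable def gpoly (s d : ℝ) : ℝ :=
  -(s - 2) * d ^ 3 + (s ^ 2 - 2 * s - 1) * d ^ 2 - (3 * s ^ 2 - 9 * s + 5) * d
    + 2 * (s - 2) * (s - 1)

lemma gpoly_regular (s t : ℕ) (h : IsRegularPair s t) : 0 ≤ gpoly s ((t : ℝ) - s) := by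
  unfold gpoly
  rcases h with ⟨h1, h2, h3⟩ | ⟨rfl, rfl⟩ | ⟨rfl, rfl⟩
  · obtain ⟨u, rfl⟩ : ∃ u, t = s + 3 + u := ⟨t - (s + 3), by omega⟩
    obtain ⟨v, hv⟩ : ∃ v, s = u + v + 7 := ⟨s - (u + 7), by omega⟩
    have hx : (0 : ℝ) ≤ (s : ℝ) - 11 := by
      have : (11 : ℝ) ≤ s := by exact_mod_cast h1
      linarith
    have hvr : (v : ℝ) = (s : ℝ) - u - 7 := by
      have : (s : ℝ) = u + v + 7 := by exact_mod_cast hv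
      linarith
    have hu0 : (0 : ℝ) ≤ u := Nat.cast_nonneg u
    have hv0 : (0 : ℝ) ≤ v := Nat.cast_nonneg v
    have hp : (0 : ℝ) ≤ u * v * (((s : ℝ) - 11 + 9) * (u + 3) - (s - 3)) :=
      mul_nonneg (mul_nonneg hu0 hv0) (by nlinarith [mul_nonneg hx hu0])
    have e0 : (0 : ℝ) ≤ 2 * (s : ℝ) ^ 2 - 24 * s + 34 := by nlinarith
    -- value at `d = s - 4`, times the interpolation weights
    have e1 : (0 : ℝ) ≤ -((s : ℝ) - 2) * (s - 4) ^ 3 + (s ^ 2 - 2 * s - 1) * (s - 4) ^ 2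
        - (3 * s ^ 2 - 9 * s + 5) * (s - 4) + 2 * (s - 2) * (s - 1) := by
      obtain ⟨x, hxd⟩ : ∃ x : ℝ, x = (s : ℝ) - 11 := ⟨_, rfl⟩
      rw [← hxd] at hx
      rw [show (s : ℝ) = x + 11 by linarith]
      ring_nf; positivity
    have hs7 : (0 : ℝ) < (s : ℝ) - 7 := by linarith
    have m0 := mul_nonneg hv0 e0
    have m1 := mul_nonneg hu0 e1
    have mp := mul_nonneg hs7.le hp
    refine nonneg_of_mul_nonneg_right ?_ hs7
    rw [hvr] at m0 mp
    push_cast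
    linarith
  · norm_num
  · norm_num

lemma gpoly_exceptional (s t : ℕ) (hs : 3 ≤ s) (ht1 : s + 2 ≤ t) (ht2 : t ≤ 2 * s - 1)
    (h : ¬ IsRegularPair s t) : gpoly s ((t : ℝ) - s) ≤ 0 := by
  unfold gpoly
  unfold IsRegularPair at h
  by_cases h10 : s ≤ 10
  · have ht3 : t ≤ 19 := by omega
    interval_cases s <;> interval_cases t <;> first | omega | norm_num
  · have hx : (11 : ℝ) ≤ s := by
      have : 11 ≤ s := by omega
      exact_mod_cast this
    obtain ⟨x, hxd⟩ : ∃ x : ℝ, x = (s : ℝ) - 11 := ⟨_, rfl⟩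
    have hx0 : 0 ≤ x := by linarith
    have hsx : (s : ℝ) = x + 11 := by linarith
    have hc : t = s + 2 ∨ t + 1 = 2 * s ∨ t + 2 = 2 * s ∨ t + 3 = 2 * s := by omega
    rw [← neg_nonneg]
    rcases hc with hc | hc | hc | hc
    · have e : (t : ℝ) = s + 2 := by exact_mod_cast hc
      rw [e, hsx]; ring_nf; positivity
    · have e : (t : ℝ) + 1 = 2 * s := by exact_mod_cast hc
      rw [show (t : ℝ) = 2 * s - 1 by linarith, hsx]; ring_nf; positivity
    · have e : (t : ℝ) + 2 = 2 * s := by exact_mod_cast hc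
      rw [show (t : ℝ) = 2 * s - 2 by linarith, hsx]; ring_nf; positivity
    · have e : (t : ℝ) + 3 = 2 * s := by exact_mod_cast hc
      rw [show (t : ℝ) = 2 * s - 3 by linarith, hsx]; ring_nf; positivity

lemma eta_eq (s t : ℕ) : EReta s t = 2 - (s : ℝ) + (2 * s - 3) * ERalpha s t := by
  unfold EReta ERdelta; ring

lemma gpoly_id (s t : ℝ) :
    ((t - s) * (2 * s - 3) + (s - 2) ^ 2) * ((2 * s - 3) * ((t - s) * (s - 1)) + 2 * s - t) * 2 -
    (t * (s - 2) - s + 3) * ((2 * s - 3) * ((t - s) * (t + s - 1)) - 2 * (s - 2)) =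
    (2 * s - 3) * gpoly s (t - s) := by
  unfold gpoly; ring

lemma eta_facts (s t : ℕ) (hs : 3 ≤ s) (ht1 : s + 2 ≤ t) (ht2 : t ≤ 2 * s - 1) :
    2 * (((t : ℝ) - s) * (2 * s - 3) + ((s : ℝ) - 2) ^ 2) ≤
      EReta s t * ((2 * s - 3) * (((t : ℝ) - s) * (t + s - 1)) - 2 * (s - 2)) ∧
    (t : ℝ) * (s - 2) - s + 3 ≤
      EReta s t * ((2 * s - 3) * (((t : ℝ) - s) * (s - 1)) + 2 * s - t) ∧
    EReta s t ≤ 1 / 2 := by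
  have hs' : (3 : ℝ) ≤ s := by exact_mod_cast hs
  have hst : (s : ℝ) + 2 ≤ t := by exact_mod_cast ht1
  have hts : (t : ℝ) + 1 ≤ 2 * s := by
    have : t + 1 ≤ 2 * s := by omega
    exact_mod_cast this
  have hid := gpoly_id (s : ℝ) (t : ℝ)
  have ha : (0 : ℝ) < 2 * s - 3 := by linarith
  have hdp : (0 : ℝ) < (2 * s - 3) * (((t : ℝ) - s) * (s - 1)) + 2 * s - t := by
    have : (0 : ℝ) < (2 * s - 3) * (((t : ℝ) - s) * (s - 1)) :=
      mul_pos ha (mul_pos (by linarith) (by linarith))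
    linarith
  have hdr : (0 : ℝ) < (2 * s - 3) * (((t : ℝ) - s) * (t + s - 1)) - 2 * (s - 2) := by
    have h1 : (1 : ℝ) ≤ ((t : ℝ) - s) * (t + s - 1) := by nlinarith
    nlinarith
  have heta := eta_eq s t
  by_cases hreg : IsRegularPair s t
  · have hα : ERalpha s t * ((2 * (s : ℝ) - 3) * ((t : ℝ) - (s : ℝ)) * ((t : ℝ) + (s : ℝ) - 1)
        - 2 * (s : ℝ) + 4) =
        (((s : ℝ) - 2) * ((t : ℝ) - (s : ℝ)) * ((t : ℝ) + (s : ℝ) - 1) + 2 * (t : ℝ) - 2 * (s : ℝ)) := by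
      unfold ERalpha
      rw [if_pos hreg]
      apply div_mul_cancel₀
      intro h0; linarith
    have hη : EReta s t * ((2 * s - 3) * (((t : ℝ) - s) * (t + s - 1)) - 2 * (s - 2)) =
        2 * (((t : ℝ) - s) * (2 * s - 3) + ((s : ℝ) - 2) ^ 2) := by
      rw [heta]; linear_combination (2 * (s : ℝ) - 3) * hα
    have hg := mul_nonneg ha.le (gpoly_regular s t hreg)
    refine ⟨hη.ge, ?_, ?_⟩
    · refine le_of_mul_le_mul_right ?_ hdr
      have e : EReta s t * ((2 * s - 3) * (((t : ℝ) - s) * (s - 1)) + 2 * s - t) *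
          ((2 * s - 3) * (((t : ℝ) - s) * (t + s - 1)) - 2 * (s - 2)) =
          2 * (((t : ℝ) - s) * (2 * s - 3) + ((s : ℝ) - 2) ^ 2) *
          ((2 * s - 3) * (((t : ℝ) - s) * (s - 1)) + 2 * s - t) := by
        rw [← hη]; ring
      rw [e]; linarith
    · refine le_of_mul_le_mul_right ?_ hdr
      rw [hη]
      have hd : (s : ℝ) + 3 ≤ t := by
        have : s + 3 ≤ t := by unfold IsRegularPair at hreg; omega
        exact_mod_cast this
      obtain ⟨u, hu⟩ : ∃ u : ℝ, u = t - s - 3 := ⟨_, rfl⟩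
      obtain ⟨v, hv⟩ : ∃ v : ℝ, v = 2 * s - t - 1 := ⟨_, rfl⟩
      have hu0 : 0 ≤ u := by linarith
      have hv0 : 0 ≤ v := by linarith
      have e1 : (s : ℝ) = u + v + 4 := by linarith
      have e2 : (t : ℝ) = 2 * u + v + 7 := by linarith
      rw [e1, e2, ← sub_nonneg]
      ring_nf; positivity
  · have hα : ERalpha s t * ((2 * (s : ℝ) - 3) * ((t : ℝ) - (s : ℝ)) * ((s : ℝ) - 1)
        + 2 * (s : ℝ) - (t : ℝ)) =
        (((s : ℝ) - 2) * ((t : ℝ) - (s : ℝ)) * ((s : ℝ) - 1) + (s : ℝ) - 1) := by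
      unfold ERalpha
      rw [if_neg hreg]
      apply div_mul_cancel₀
      intro h0; linarith
    have hη : EReta s t * ((2 * s - 3) * (((t : ℝ) - s) * (s - 1)) + 2 * s - t) =
        (t : ℝ) * (s - 2) - s + 3 := by
      rw [heta]; linear_combination (2 * (s : ℝ) - 3) * hα
    have hg := mul_nonpos_of_nonneg_of_nonpos ha.le (gpoly_exceptional s t hs ht1 ht2 hreg)
    refine ⟨?_, hη.ge, ?_⟩
    · refine le_of_mul_le_mul_right ?_ hdp
      have e : EReta s t * ((2 * s - 3) * (((t : ℝ) - s) * (t + s - 1)) - 2 * (s - 2)) *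
          ((2 * s - 3) * (((t : ℝ) - s) * (s - 1)) + 2 * s - t) =
          ((t : ℝ) * (s - 2) - s + 3) *
          ((2 * s - 3) * (((t : ℝ) - s) * (t + s - 1)) - 2 * (s - 2)) := by
        rw [← hη]; ring
      rw [e]; linarith
    · refine le_of_mul_le_mul_right ?_ hdp
      rw [hη]
      obtain ⟨u, hu⟩ : ∃ u : ℝ, u = t - s - 2 := ⟨_, rfl⟩
      obtain ⟨v, hv⟩ : ∃ v : ℝ, v = 2 * s - t - 1 := ⟨_, rfl⟩
      have hu0 : 0 ≤ u := by linarith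
      have hv0 : 0 ≤ v := by linarith
      have e1 : (s : ℝ) = u + v + 3 := by linarith
      have e2 : (t : ℝ) = 2 * u + v + 5 := by linarith
      rw [e1, e2, ← sub_nonneg]
      ring_nf; positivity

/-- Every scheme has nonpositive value. -/
lemma value_univ_nonpos (s t : ℕ) (hs : 3 ≤ s) (ht1 : s + 2 ≤ t) (ht2 : t ≤ 2 * s - 1)
    (Q : ColourScheme s t) : subconfigValue Q Finset.univ ≤ 0 := by
  have hs' : (3 : ℝ) ≤ s := by exact_mod_cast hs
  have hst : (s : ℝ) + 2 ≤ t := by exact_mod_cast ht1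
  have hts : (t : ℝ) + 1 ≤ 2 * s := by
    have : t + 1 ≤ 2 * s := by omega
    exact_mod_cast this
  have ha : (0 : ℝ) < 2 * s - 3 := by linarith
  obtain ⟨f2, f4, f7⟩ := eta_facts s t hs ht1 ht2
  have heta := eta_eq s t
  rw [value_univ, sub_nonpos]
  generalize EReta s t = η at *
  obtain ⟨β, hβd⟩ : ∃ β, β = 1 - ERalpha s t := ⟨_, rfl⟩
  have hβ : (2 * (s : ℝ) - 3) * β = s - 1 - η := by rw [hβd, heta]; ring
  rw [← hβd]
  obtain ⟨h3, h6, h5⟩ := arith_low s t β η hst hts hβ f4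
  by_cases hB : ∀ D ∈ Q.blocks, D.card ≤ t - s
  · exact total_small ht1 Q β η h3 h5 hB
  · push Not at hB
    obtain ⟨M, hM, hMc⟩ := hB
    refine total_large hs ht1 Q β η ?_ h3 ?_ h6 ?_ M hM (by omega)
    · refine le_of_mul_le_mul_left ?_ ha
      have e : (2 * (s : ℝ) - 3) * (((s : ℝ) - 2) * β + η * (((t : ℝ) - s) * (t + s - 1) / 2)) =
        ((s : ℝ) - 2) * (s - 1 - η) + (2 * (s : ℝ) - 3) * (η * (((t : ℝ) - s) * (t + s - 1) / 2)) := by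
        rw [← hβ]; ring
      rw [e]; linarith
    · refine le_of_mul_le_mul_left ?_ ha
      have e : (2 * (s : ℝ) - 3) * (((t : ℝ) - 3) * β + η + η * (((t : ℝ) - s) * (s - 1))) =
        ((t : ℝ) - 3) * (s - 1 - η) + (2 * (s : ℝ) - 3) * (η + η * (((t : ℝ) - s) * (s - 1))) := by
        rw [← hβ]; ring
      rw [e]; linarith
    · refine le_of_mul_le_mul_left ?_ ha
      rw [hβ]; nlinarith

/-- **Lemma (corefacts).** Among all induced subconfigurations of a scheme `Q` on at
least two nodes, the minimal value is at most `0`; and any induced subconfiguration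
attaining this minimal value which has the maximal number of nodes among such
minimizers has at least `3` nodes. -/
theorem core_facts (s t : ℕ) (hs : 3 ≤ s) (ht1 : s + 2 ≤ t) (ht2 : t ≤ 2 * s - 1)
    (Q : ColourScheme s t) :
    (∀ S : Finset (Fin t), 2 ≤ S.card →
      (∀ S' : Finset (Fin t), 2 ≤ S'.card → subconfigValue Q S ≤ subconfigValue Q S') →
      subconfigValue Q S ≤ 0) ∧
    (∀ S : Finset (Fin t), 2 ≤ S.card →
      (∀ S' : Finset (Fin t), 2 ≤ S'.card → subconfigValue Q S ≤ subconfigValue Q S') →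
      (∀ S' : Finset (Fin t), 2 ≤ S'.card →
        subconfigValue Q S' = subconfigValue Q S → S'.card ≤ S.card) →
      3 ≤ S.card) := by
  constructor
  · intro S _ hmin
    obtain ⟨S', _, hS'⟩ := Finset.exists_subset_card_eq
      (show 2 ≤ (Finset.univ : Finset (Fin t)).card by
        rw [Finset.card_univ, Fintype.card_fin]; omega)
    have h := hmin S' hS'.ge
    rwa [value_pair Q S' hS'] at h
  · intro S hS hmin hmax
    by_contra hlt
    have hS2 : S.card = 2 := by omega
    have hcu : (Finset.univ : Finset (Fin t)).card = t := by simp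
    have h0 := value_pair Q S hS2
    have h1 := hmin Finset.univ (by omega)
    have h2 := value_univ_nonpos s t hs ht1 ht2 Q
    have h3 := hmax Finset.univ (by omega) (by linarith)
    omega
end

section
/- Let s ≥ 3 and s+2 ≤ t ≤ 2s-1 be integers. Suppose Q is a colour scheme for K_t with parameter s such that v(Q') ≤ v(Q) for every colour scheme Q' for K_t with parameter s, and suppose that no block of Q has size s. Then v(Q) ≤ 0. -/
/-- Numeric facts, abstract form of the derivation. -/
theorem numeric_core (s t : ℕ) (hs : 3 ≤ s) (ht1 : s + 2 ≤ t) (ht2 : t ≤ 2 * s - 1)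
    (a e : ℝ) (ha : a = 1 - ERalpha s t) (he : e = ((s : ℝ) - 1) - (2 * s - 3) * a) :
    0 < e ∧ e ≤ a ∧
    ((s : ℝ) - 2) * ((s + 1) * (e / 2) - a) ≤ ((t : ℝ) - 2) * ((t + 1) * (e / 2) - 1) ∧
    ((s : ℝ) - 2) * ((s + 1) * (e / 2) - a) + ((t : ℝ) - s - 1) * ((t - s + 2) * (e / 2) - a)
      ≤ ((t : ℝ) - 2) * ((t + 1) * (e / 2) - 1) ∧
    0 ≤ (s + 1) * (e / 2) - a := by
  obtain ⟨r, rfl⟩ : ∃ r, t = s + r := ⟨t - s, by omega⟩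
  have hr2 : (2 : ℝ) ≤ r := by
    have : 2 ≤ r := by omega
    exact_mod_cast this
  have hrs : (r : ℝ) + 1 ≤ s := by
    have : r + 1 ≤ s := by omega
    exact_mod_cast this
  have hs3 : (3 : ℝ) ≤ s := by exact_mod_cast hs
  have key : ∃ D A H : ℝ, 0 < D ∧ a * D = A ∧ e * D = H ∧ 0 < H ∧ H ≤ A ∧
      ((s : ℝ) - 2) * ((s + 1) * (H / 2) - A) ≤ ((s + r : ℝ) - 2) * ((s + r + 1) * (H / 2) - D) ∧
      ((s : ℝ) - 2) * ((s + 1) * (H / 2) - A) + ((r : ℝ) - 1) * ((r + 2) * (H / 2) - A)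
        ≤ ((s + r : ℝ) - 2) * ((s + r + 1) * (H / 2) - D) ∧
      0 ≤ (s + 1) * (H / 2) - A := by
    by_cases hreg : IsRegularPair s (s + r)
    · have hr3 : 3 ≤ r ∧ r + 4 ≤ s ∧ 10 ≤ s ∧ (s = 10 → r = 4 ∨ r = 5) := by
        unfold IsRegularPair at hreg
        omega
      obtain ⟨h3, h4, h10, h5⟩ := hr3
      obtain ⟨p, rfl⟩ : ∃ p, r = p + 3 := ⟨r - 3, by omega⟩
      obtain ⟨q, rfl⟩ : ∃ q, s = p + 7 + q := ⟨s - p - 7, by omega⟩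
      have hp : (0 : ℝ) ≤ p := by positivity
      have hq : (0 : ℝ) ≤ q := by positivity
      have hD : (0 : ℝ) < (2 * ((p + 7 + q : ℕ) : ℝ) - 3) * ((p + 3 : ℕ) : ℝ) *
          (2 * ((p + 7 + q : ℕ) : ℝ) + ((p + 3 : ℕ) : ℝ) - 1) - 2 * ((p + 7 + q : ℕ) : ℝ) + 4 := by
        push_cast
        ring_nf
        positivity
      have hα : ERalpha (p + 7 + q) (p + 7 + q + (p + 3)) * ((2 * ((p + 7 + q : ℕ) : ℝ) - 3) * ((p + 3 : ℕ) : ℝ) *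
          (2 * ((p + 7 + q : ℕ) : ℝ) + ((p + 3 : ℕ) : ℝ) - 1) - 2 * ((p + 7 + q : ℕ) : ℝ) + 4) =
          (((p + 7 + q : ℕ) : ℝ) - 2) * ((p + 3 : ℕ) : ℝ) *
          (2 * ((p + 7 + q : ℕ) : ℝ) + ((p + 3 : ℕ) : ℝ) - 1) + 2 * ((p + 3 : ℕ) : ℝ) := by
        rw [ERalpha, if_pos hreg, div_mul_eq_mul_div, div_eq_iff]
        · push_cast
          ring
        · push_cast at hD ⊢
          apply ne_of_gt
          linarith
      -- the one nontrivial inequality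
      have hx : ((p + 3 : ℝ) + 2) * ((p + 7 + q - 2 : ℝ) ^ 2 + (2 * (p + 7 + q) - 3) * (p + 3)) ≤
          (p + 3) * (2 * (p + 7 + q) + (p + 3) - 1) * (p + 7 + q - 1) - 2 * (p + 7 + q + (p + 3) - 2) := by
        have hb : (0 : ℝ) ≤ (p + 7 + q) * ((q - 1) * (p + 1) - 4) + 2 * (p + 3) ^ 2 + (p + 3) - 4 := by
          obtain h | h | h | ⟨h, h'⟩ | ⟨h, h'⟩ : (q = 0 ∧ 4 ≤ p) ∨ (q = 1 ∧ 2 ≤ p) ∨ (q = 2 ∧ 1 ≤ p) ∨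
              (4 ≤ q ∧ p = 0) ∨ (3 ≤ q ∧ 1 ≤ p) := by omega
          · obtain ⟨rfl, h⟩ := h
            have h' : (4 : ℝ) ≤ p := by exact_mod_cast h
            push_cast
            nlinarith
          · obtain ⟨rfl, h⟩ := h
            have h' : (2 : ℝ) ≤ p := by exact_mod_cast h
            push_cast
            nlinarith
          · obtain ⟨rfl, h⟩ := h
            have h' : (1 : ℝ) ≤ p := by exact_mod_cast h
            push_cast
            nlinarith
          · subst h'
            have h' : (4 : ℝ) ≤ q := by exact_mod_cast h
            push_cast
            nlinarith
          · have h1 : (3 : ℝ) ≤ q := by exact_mod_cast h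
            have h2 : (1 : ℝ) ≤ p := by exact_mod_cast h'
            have h3 : (0 : ℝ) ≤ (q - 1) * (p + 1) - 4 := by nlinarith
            have h4 := mul_nonneg (by positivity : (0 : ℝ) ≤ (p + 7 + q : ℝ)) h3
            nlinarith
        linarith
      refine ⟨_, _, _, hD, rfl, rfl, ?_⟩
      have hA : a * ((2 * ((p + 7 + q : ℕ) : ℝ) - 3) * ((p + 3 : ℕ) : ℝ) *
          (2 * ((p + 7 + q : ℕ) : ℝ) + ((p + 3 : ℕ) : ℝ) - 1) - 2 * ((p + 7 + q : ℕ) : ℝ) + 4) =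
          (p + 3) * (2 * (p + 7 + q) + (p + 3) - 1) * (p + 7 + q - 1) - 2 * (p + 7 + q + (p + 3) - 2) := by
        rw [ha, sub_mul, hα]
        push_cast
        ring
      have hH : e * ((2 * ((p + 7 + q : ℕ) : ℝ) - 3) * ((p + 3 : ℕ) : ℝ) *
          (2 * ((p + 7 + q : ℕ) : ℝ) + ((p + 3 : ℕ) : ℝ) - 1) - 2 * ((p + 7 + q : ℕ) : ℝ) + 4) =
          2 * ((p + 7 + q - 2 : ℝ) ^ 2 + (2 * (p + 7 + q) - 3) * (p + 3)) := by
        have hA' := hA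
        rw [he]
        push_cast at hA' ⊢
        linear_combination (-(2 * ((p : ℝ) + 7 + q) - 3)) * hA'
      rw [hA, hH]
      push_cast
      refine ⟨?_, ?_, ?_, ?_, ?_⟩
      · ring_nf; positivity
      · refine le_trans ?_ hx
        have : (0:ℝ) ≤ ((p + 7 + q - 2 : ℝ) ^ 2 + (2 * (p + 7 + q) - 3) * (p + 3)) := by
          ring_nf; positivity
        nlinarith
      · apply le_of_eq; ring
      · have h0 : ((p:ℝ) + 3 - 1) * ((p + 3 + 2) * (2 * ((p + 7 + q - 2 : ℝ) ^ 2 + (2 * (p + 7 + q) - 3) * (p + 3)) / 2) - ((p + 3) * (2 * (p + 7 + q) + (p + 3) - 1) * (p + 7 + q - 1) - 2 * (p + 7 + q + (p + 3) - 2))) ≤ 0 := by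
          apply mul_nonpos_of_nonneg_of_nonpos
          · linarith
          · linarith
        refine le_trans (add_le_add_right h0 _) ?_
        apply le_of_eq; ring
      · ring_nf
        positivity
    · have hcase : r = 2 ∨ s ≤ 10 ∨ s ≤ r + 3 := by
        unfold IsRegularPair at hreg
        omega
      have hcase2 : s = 10 → r ≠ 4 ∧ r ≠ 5 := by
        unfold IsRegularPair at hreg
        omega
      have hD : (0 : ℝ) < (2 * (s : ℝ) - 3) * r * (s - 1) + s - r := by
        have h1 : 0 ≤ (2 * (s : ℝ) - 3) * r * (s - 1) := by
          apply mul_nonneg (mul_nonneg _ _) <;> linarith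
        linarith
      have hα : ERalpha s (s + r) * ((2 * (s : ℝ) - 3) * r * (s - 1) + s - r) =
          ((s : ℝ) - 2) * r * (s - 1) + s - 1 := by
        rw [ERalpha, if_neg hreg, div_mul_eq_mul_div, div_eq_iff]
        · push_cast
          ring
        · push_cast at hD ⊢
          apply ne_of_gt
          linarith
      have hx : 2 * ((r : ℝ) * s * (s - 2) + 1) ≤ (r + 2) * ((s - 2) * (s + r - 1) + 1) := by
        have hb : 0 ≤ ((s : ℝ) - 2) * (2 * s + r ^ 2 + r - 2 - r * s) + r := by
          rcases hcase with h | h | h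
          · subst h
            push_cast
            nlinarith
          · have hrb : r ≤ 9 := by omega
            have hr2' : 2 ≤ r := by omega
            have hrs' : r + 1 ≤ s := by omega
            clear * - h hrb hr2' hrs' hcase2 hs
            interval_cases s <;> interval_cases r <;> first | omega | norm_num
          · have h' : (s : ℝ) ≤ r + 3 := by exact_mod_cast h
            have : 0 ≤ 2 * (s : ℝ) + r ^ 2 + r - 2 - r * s := by nlinarith
            have := mul_nonneg (by linarith : (0 : ℝ) ≤ (s : ℝ) - 2) this
            linarith
        linarith
      refine ⟨_, _, _, hD, rfl, rfl, ?_⟩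
      have hA : a * ((2 * (s : ℝ) - 3) * r * (s - 1) + s - r) = (r : ℝ) * s * (s - 2) + 1 := by
        rw [ha, sub_mul, hα]
        ring
      have hH : e * ((2 * (s : ℝ) - 3) * r * (s - 1) + s - r) = (s - 2) * (s + r - 1) + 1 := by
        rw [he]
        linear_combination (-(2 * (s : ℝ) - 3)) * hA
      rw [hA, hH]
      have hHpos : (0 : ℝ) < (s - 2) * (s + r - 1) + 1 := by
        have : (0 : ℝ) ≤ (s - 2) * (s + r - 1) := by
          apply mul_nonneg <;> linarith
        linarith
      refine ⟨hHpos, ?_, ?_, ?_, ?_⟩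
      · nlinarith [mul_nonneg (mul_nonneg (sub_nonneg.2 hr2) (sub_nonneg.2 hs3)) (sub_nonneg.2 hs3), mul_nonneg (sub_nonneg.2 hr2) (sub_nonneg.2 hs3)]
      · have h0 : 0 ≤ ((r : ℝ) - 1) * ((r + 2) * (((s - 2) * (s + r - 1) + 1) / 2) - ((r : ℝ) * s * (s - 2) + 1)) := by
          apply mul_nonneg <;> linarith
        refine le_trans (le_add_of_nonneg_right h0) ?_
        apply le_of_eq; ring
      · apply le_of_eq; ring
      · nlinarith
  obtain ⟨D, A, H, hD, hA, hH, h1, h2, h3, h4, h5⟩ := key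
  subst hA hH
  push_cast
  refine ⟨pos_of_mul_pos_left h1 hD.le, le_of_mul_le_mul_right h2 hD,
    le_of_mul_le_mul_right (a := D) ?_ hD, le_of_mul_le_mul_right (a := D) ?_ hD, 
    le_of_mul_le_mul_right (a := D) ?_ hD⟩
  · linarith
  · linarith
  · linarith

theorem ColourScheme.sum_pairs {s t : ℕ} (Q : ColourScheme s t) :
    ∑ D ∈ Q.blocks, ((D.card : ℝ) * (D.card - 1)) = (t : ℝ) * (t - 1) := by
  have h1 : (Finset.univ : Finset (Fin t)).offDiag = Q.blocks.biUnion Finset.offDiag := by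
    ext ⟨x, y⟩
    simp only [Finset.mem_offDiag, Finset.mem_univ, true_and, Finset.mem_biUnion]
    constructor
    · intro h
      obtain ⟨D, ⟨hD, hx, hy⟩, -⟩ := Q.existsUnique_block x y h
      exact ⟨D, hD, hx, hy, h⟩
    · rintro ⟨D, -, -, -, h⟩
      exact h
  have h2 := congrArg Finset.card h1
  rw [Finset.card_biUnion] at h2
  · simp only [Finset.offDiag_card, Finset.card_univ, Fintype.card_fin] at h2
    have h3 : ((t * t - t : ℕ) : ℝ) = ((∑ u ∈ Q.blocks, (u.card * u.card - u.card) : ℕ) : ℝ) := by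
      rw [h2]
    rw [Nat.cast_sub (Nat.le_mul_self t)] at h3
    push_cast at h3
    rw [mul_sub, mul_one, h3]
    refine Finset.sum_congr rfl fun D _ => ?_
    rw [Nat.cast_sub (Nat.le_mul_self _)]
    push_cast
    ring
  · intro D hD D' hD' hne
    rw [Function.onFun, Finset.disjoint_left]
    rintro ⟨x, y⟩ h h'
    rw [Finset.mem_offDiag] at h h'
    exact hne ((Q.existsUnique_block x y h.2.2).unique ⟨hD, h.1, h.2.1⟩ ⟨hD', h'.1, h'.2.1⟩)

theorem ColourScheme.inter_le {s t : ℕ} (Q : ColourScheme s t) (B D : Finset (Fin t))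
    (hB : B ∈ Q.blocks) (hD : D ∈ Q.blocks) (hne : D ≠ B) : (D ∩ B).card ≤ 1 := by
  rw [Finset.card_le_one]
  intro x hx y hy
  rw [Finset.mem_inter] at hx hy
  by_contra h
  exact hne ((Q.existsUnique_block x y h).unique ⟨hD, hx.1, hy.1⟩ ⟨hB, hx.2, hy.2⟩)

theorem ColourScheme.card_le_sdiff {s t : ℕ} (Q : ColourScheme s t) (B D : Finset (Fin t))
    (hB : B ∈ Q.blocks) (hD : D ∈ Q.blocks) (hne : D ≠ B) : D.card ≤ (D \ B).card + 1 := by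
  have := Q.inter_le B D hB hD hne
  have := Finset.card_sdiff_add_card_inter D B
  omega

theorem ColourScheme.card_add_le {s t : ℕ} (Q : ColourScheme s t) (B D : Finset (Fin t))
    (hB : B ∈ Q.blocks) (hD : D ∈ Q.blocks) (hne : D ≠ B) : D.card + B.card ≤ t + 1 := by
  have h1 := Q.card_le_sdiff B D hB hD hne
  have h2 : (D \ B).card ≤ (Bᶜ).card :=
    Finset.card_le_card (by intro x hx; simp at hx ⊢; exact hx.2)
  have h3 := Finset.card_add_card_compl B
  rw [Fintype.card_fin] at h3
  omega

theorem ColourScheme.sum_outside {s t : ℕ} (Q : ColourScheme s t) (B : Finset (Fin t))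
    (hB : B ∈ Q.blocks) :
    ∑ D ∈ Q.blocks.erase B, (((D.card : ℝ) - 1) * (D.card - 2)) ≤
      ((t : ℝ) - B.card) * (t - B.card - 1) := by
  have h1 : (Q.blocks.erase B).biUnion (fun D => (D \ B).offDiag) ⊆ (Bᶜ).offDiag := by
    rintro ⟨x, y⟩ h
    simp only [Finset.mem_offDiag, Finset.mem_biUnion, Finset.mem_sdiff, Finset.mem_compl] at h ⊢
    obtain ⟨D, -, hx, hy, h⟩ := h
    exact ⟨hx.2, hy.2, h⟩
  have h2 := Finset.card_le_card h1
  rw [Finset.card_biUnion] at h2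
  · have h3 := Finset.card_add_card_compl B
    rw [Fintype.card_fin] at h3
    have h3' : ((Bᶜ).card : ℝ) = t - B.card := by
      have h3r : (B.card : ℝ) + (Bᶜ).card = t := by exact_mod_cast h3
      linarith
    simp only [Finset.offDiag_card] at h2
    have h4 : ((∑ u ∈ Q.blocks.erase B, ((u \ B).card * (u \ B).card - (u \ B).card) : ℕ) : ℝ) ≤
        (((Bᶜ).card * (Bᶜ).card - (Bᶜ).card : ℕ) : ℝ) := by exact_mod_cast h2
    rw [Nat.cast_sub (Nat.le_mul_self _)] at h4
    push_cast at h4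
    rw [h3'] at h4
    refine le_trans (Finset.sum_le_sum fun D hD => ?_) (h4.trans (le_of_eq (by ring)))
    rw [Finset.mem_erase] at hD
    rw [Nat.cast_sub (Nat.le_mul_self _)]
    push_cast
    have h5 : (D.card : ℝ) ≤ (D \ B).card + 1 := by
      exact_mod_cast Q.card_le_sdiff B D hB hD.2 hD.1
    have h6 : (2 : ℝ) ≤ D.card := by exact_mod_cast Q.two_le_card D hD.2
    nlinarith
  · intro D hD D' hD' hne
    rw [Function.onFun, Finset.disjoint_left]
    rintro ⟨x, y⟩ h h'
    rw [Finset.mem_offDiag, Finset.mem_sdiff, Finset.mem_sdiff] at h h'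
    exact hne ((Q.existsUnique_block x y h.2.2).unique
      ⟨Finset.mem_of_mem_erase hD, h.1.1, h.2.1.1⟩ ⟨Finset.mem_of_mem_erase hD', h'.1.1, h'.2.1.1⟩)

/-- Bounding the total gain by the gain of one block plus a multiple of the pairs outside. -/
theorem ColourScheme.gain_le {s t : ℕ} (Q : ColourScheme s t) (B : Finset (Fin t))
    (hB : B ∈ Q.blocks) (a h c : ℝ) (hc : 0 ≤ c)
    (hD : ∀ D ∈ Q.blocks, D ≠ B → ((D.card : ℝ) + 1) * h - a ≤ c * (D.card - 1)) :
    ∑ D ∈ Q.blocks, ((D.card : ℝ) - 2) * ((D.card + 1) * h - a) ≤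
      ((B.card : ℝ) - 2) * ((B.card + 1) * h - a) + c * (((t : ℝ) - B.card) * (t - B.card - 1)) := by
  rw [← Finset.add_sum_erase _ _ hB]
  gcongr
  refine le_trans ?_ (mul_le_mul_of_nonneg_left (Q.sum_outside B hB) hc)
  rw [Finset.mul_sum]
  refine Finset.sum_le_sum fun D hD' => ?_
  rw [Finset.mem_erase] at hD'
  have h6 : (2 : ℝ) ≤ D.card := by exact_mod_cast Q.two_le_card D hD'.2
  have := mul_le_mul_of_nonneg_left (hD D hD'.2 hD'.1) (sub_nonneg.2 h6)
  linarith

/-- **Lemma (reduction).** If `Q` is a colour scheme for `K_t` with parameter `s` of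
maximal value among all such schemes, and no block of `Q` has size `s`, then
`v(Q) ≤ 0`. -/
theorem schemeValue_nonpos_of_maximal_no_sBlock (s t : ℕ) (hs : 3 ≤ s) (ht1 : s + 2 ≤ t)
    (ht2 : t ≤ 2 * s - 1) (Q : ColourScheme s t)
    (hmax : ∀ Q' : ColourScheme s t, schemeValue Q' ≤ schemeValue Q)
    (hno : ∀ D ∈ Q.blocks, D.card ≠ s) :
    schemeValue Q ≤ 0 := by
  obtain ⟨a, ha⟩ : ∃ a, a = 1 - ERalpha s t := ⟨_, rfl⟩
  obtain ⟨e, he⟩ : ∃ e, e = ((s : ℝ) - 1) - (2 * s - 3) * a := ⟨_, rfl⟩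
  obtain ⟨he0, hea, hc1, hc2, hc3⟩ := numeric_core s t hs ht1 ht2 a e ha he
  have hs3 : (3 : ℝ) ≤ s := by exact_mod_cast hs
  have hts : (s : ℝ) + 2 ≤ t := by exact_mod_cast ht1
  have hts2 : (t : ℝ) + 1 ≤ 2 * s := by
    have : t + 1 ≤ 2 * s := by omega
    exact_mod_cast this
  obtain ⟨h, rfl⟩ : ∃ h, e = 2 * h := ⟨e / 2, by ring⟩
  have hh : 2 * h / 2 = h := by ring
  rw [hh] at hc1 hc2 hc3
  have hval : schemeValue Q = ∑ D ∈ Q.blocks, ((D.card : ℝ) - 2) * ((D.card + 1) * h - a) -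
      ((t : ℝ) - 2) * ((t + 1) * h - 1) := by
    have h1 : ∑ D ∈ Q.blocks, ((D.card : ℝ) - 2) * ((D.card + 1) * h - a) =
        h * ∑ D ∈ Q.blocks, ((D.card : ℝ) * (D.card - 1)) - a * ∑ D ∈ Q.blocks, (D.card : ℝ)
          + Q.blocks.card * (2 * a - 2 * h) := by
      rw [Finset.mul_sum, Finset.mul_sum, ← Finset.sum_sub_distrib, ← nsmul_eq_mul,
        ← Finset.sum_const, ← Finset.sum_add_distrib]
      refine Finset.sum_congr rfl fun D _ => ?_
      ring
    rw [h1, Q.sum_pairs]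
    have hα : ERalpha s t = 1 - a := by linarith
    have hδ : ERdelta s t = 2 * a - 2 * h := by
      rw [ERdelta, hα, he]; ring
    rw [schemeValue, hα, hδ]
    ring
  have hT : 0 ≤ ((t : ℝ) - 2) * ((t + 1) * h - 1) :=
    le_trans (mul_nonneg (by linarith) hc3) hc1
  rw [hval, sub_nonpos]
  have hcard2 : ∀ D ∈ Q.blocks, (2 : ℝ) ≤ D.card := fun D hD => by
    exact_mod_cast Q.two_le_card D hD
  rcases Q.blocks.eq_empty_or_nonempty with hemp | hne
  · rw [hemp]; simpa using hT
  obtain ⟨B, hB, hBmax⟩ := Finset.exists_max_image Q.blocks Finset.card hne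
  have hB2 := hcard2 B hB
  have hBs : (B.card : ℝ) ≤ s := by exact_mod_cast Q.card_le_s B hB
  have hmaxR : ∀ D ∈ Q.blocks, (D.card : ℝ) ≤ B.card := fun D hD => by
    exact_mod_cast hBmax D hD
  by_cases hneg : ((B.card : ℝ) + 1) * h - a ≤ 0
  · refine le_trans (Finset.sum_nonpos fun D hD => ?_) hT
    apply mul_nonpos_of_nonneg_of_nonpos
    · linarith [hcard2 D hD]
    · nlinarith [hmaxR D hD]
  push Not at hneg
  by_cases hcs : t + 1 ≤ s + B.card
  · -- two large blocks dominate
    have hcsR : (t : ℝ) + 1 ≤ s + B.card := by exact_mod_cast hcs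
    have hmpos : (0 : ℝ) < t - B.card := by linarith
    by_cases hm : 0 ≤ ((t : ℝ) - B.card + 2) * h - a
    · refine le_trans (Q.gain_le B hB a h ((((t : ℝ) - B.card + 2) * h - a) / (t - B.card))
        (div_nonneg hm hmpos.le) ?_) (le_trans ?_ hc2)
      · intro D hD hne
        rw [div_mul_eq_mul_div, le_div_iff₀ hmpos]
        have h1 : (D.card : ℝ) + B.card ≤ t + 1 := by
          exact_mod_cast Q.card_add_le B D hB hD hne
        nlinarith [mul_nonneg (sub_nonneg.2 h1) (sub_nonneg.2 hea)]
      · have h2 : (((t : ℝ) - B.card + 2) * h - a) / (t - B.card) *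
            (((t : ℝ) - B.card) * (t - B.card - 1)) =
            (((t : ℝ) - B.card + 2) * h - a) * (t - B.card - 1) := by
          field_simp
        rw [h2]
        nlinarith [mul_nonneg (mul_nonneg (sub_nonneg.2 hcsR) (sub_nonneg.2 hBs)) he0.le]
    · push Not at hm
      refine le_trans (Q.gain_le B hB a h 0 le_rfl ?_) (le_trans ?_ hc1)
      · intro D hD hne
        have h1 : (D.card : ℝ) + B.card ≤ t + 1 := by
          exact_mod_cast Q.card_add_le B D hB hD hne
        nlinarith
      · rw [zero_mul, add_zero]
        apply mul_le_mul
        · linarith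
        · nlinarith
        · exact hneg.le
        · linarith
  · -- all blocks are small
    have hcsR : (s : ℝ) + B.card ≤ t := by
      have : s + B.card ≤ t := by omega
      exact_mod_cast this
    have hu : (0 : ℝ) < B.card - 1 := by linarith
    refine le_trans (Q.gain_le B hB a h ((((B.card : ℝ) + 1) * h - a) / (B.card - 1))
        (div_nonneg hneg.le hu.le) ?_) ?_
    · intro D hD hne
      rw [div_mul_eq_mul_div, le_div_iff₀ hu]
      nlinarith [mul_nonneg (sub_nonneg.2 (hmaxR D hD)) (sub_nonneg.2 hea)]
    · obtain ⟨u, hu'⟩ : ∃ u : ℝ, (B.card : ℝ) = u + 1 := ⟨B.card - 1, by ring⟩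
      obtain ⟨n, hn⟩ : ∃ n : ℝ, (t : ℝ) = n + 1 := ⟨t - 1, by ring⟩
      rw [hu'] at hu hB2 hneg hcsR ⊢
      rw [hn] at hcsR hts hts2 ⊢
      have hone : 1 ≤ 4 * h + 2 * (a - 2 * h) := by
        have h1 : (s - 1 : ℝ) * (4 * h + 2 * (a - 2 * h) - 1) = a - 2 * h := by
          linarith
        by_contra hcon
        push Not at hcon
        nlinarith
      have hw : 0 < u * h - (a - 2 * h) := by linarith
      have e1 : u + 1 - 1 = u := by ring
      have hu1 : 0 < u := by linarith
      rw [e1, div_mul_eq_mul_div, ← le_sub_iff_add_le', div_le_iff₀ hu1]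
      have p1 : 0 ≤ (a - 2 * h) * ((n - 1) * (n - 2 - 2 * u)) :=
        mul_nonneg (by linarith) (mul_nonneg (by linarith) (by linarith))
      have p2 : 0 ≤ (u * h - (a - 2 * h)) * ((u - 1) * (n - u - 1)) :=
        mul_nonneg hw.le (mul_nonneg (by linarith) (by linarith))
      have p3 : 0 ≤ (u * (n - 1)) * (4 * h + 2 * (a - 2 * h) - 1) :=
        mul_nonneg (mul_nonneg hu1.le (by linarith)) (by linarith)
      linarith
end
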